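/- arXiv:1310.1541 — 7 statements merged into one kernel-verified Lean document; each statement's English description precedes it below -/
import Mathlib

section
/- Fix an integer N ≥ 1 and a station X ∈ ℝ. Let u : ℝ → ℝ be 2N-times continuously differentiable, and for x ≠ X define the scaled Taylor remainder u_N(x) := (N!/(x − X)^N) · ( u(x) − Σ_{n=0}^{N−1} u⁽ⁿ⁾(X)·(x − X)ⁿ/n! ), so that u(x) = Σ_{n=0}^{N−1} u⁽ⁿ⁾(X)·(x − X)ⁿ/n! + u_N(x)·(x − X)^N/N!. Then for every ℓ with 0 ≤ ℓ ≤ N and every x ≠ X, the ℓ-th derivative of u satisfies the exact identity u⁽ℓ⁾(x) = Σ_{n=0}^{N−ℓ−1} u⁽ⁿ⁺ℓ⁾(X)·(x − X)ⁿ/n! + Σ_{n=N−ℓ}^{N} C(ℓ, N−n) · (d/dx)^{n+ℓ−N} u_N(x) · (x − X)ⁿ/n!, where C(ℓ, k) denotes the binomial coefficient ℓ choose k. -/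
lemma iteratedDeriv_taylor_monomial (X x : ℝ) (k l : ℕ) :
    iteratedDeriv l (fun z : ℝ => (z - X) ^ k / (Nat.factorial k : ℝ)) x =
      if l ≤ k then (x - X) ^ (k - l) / (Nat.factorial (k - l) : ℝ) else 0 := by
  have h1 : iteratedDeriv l (fun z : ℝ => (z - X) ^ k / (Nat.factorial k : ℝ)) x
      = (k.descFactorial l : ℝ) * (x - X) ^ (k - l) / (Nat.factorial k : ℝ) := by
    have := congrFun (iteratedDeriv_comp_sub_const l (fun z : ℝ => z ^ k) X) x
    simp only [iteratedDeriv_pow] at this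
    simp only [div_eq_mul_inv]
    rw [iteratedDeriv_mul_const_field, this]
  rw [h1]
  split_ifs with h
  · have h2 := Nat.factorial_mul_descFactorial h
    have h3 : (Nat.factorial k : ℝ) = (Nat.factorial (k - l) : ℝ) * (k.descFactorial l : ℝ) := by
      exact_mod_cast h2.symm
    have h4 : (Nat.factorial k : ℝ) ≠ 0 := by exact_mod_cast Nat.factorial_ne_zero k
    have h5 : (Nat.factorial (k - l) : ℝ) ≠ 0 := by
      exact_mod_cast Nat.factorial_ne_zero (k - l)
    rw [div_eq_div_iff h4 h5, h3]
    ring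
  · rw [Nat.descFactorial_eq_zero_iff_lt.mpr (by omega)]
    simp

/-- Exact derivative formula for a Taylor polynomial representation with remainder:
differentiating `ℓ` times the exact Taylor representation of `u` about the station `X`
keeps the scaled remainder `u_N` exactly. -/
theorem taylor_remainder_derivative_formula
    (N : ℕ) (hN : 1 ≤ N) (X : ℝ) (u : ℝ → ℝ) (hu : ContDiff ℝ (2 * N : ℕ) u)
    (uN : ℝ → ℝ)
    (huN : ∀ x : ℝ, x ≠ X → uN x = (Nat.factorial N : ℝ) / (x - X) ^ N *
      (u x - ∑ n ∈ Finset.range N,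
        iteratedDeriv n u X * (x - X) ^ n / (Nat.factorial n : ℝ))) :
    ∀ ℓ : ℕ, ℓ ≤ N → ∀ x : ℝ, x ≠ X →
      iteratedDeriv ℓ u x =
        (∑ n ∈ Finset.range (N - ℓ),
            iteratedDeriv (n + ℓ) u X * (x - X) ^ n / (Nat.factorial n : ℝ)) +
        ∑ n ∈ Finset.Icc (N - ℓ) N,
            (Nat.choose ℓ (N - n) : ℝ) * iteratedDeriv (n + ℓ - N) uN x
              * (x - X) ^ n / (Nat.factorial n : ℝ) := by
  intro ℓ hℓ x hx
  have hne : ∀ᶠ z in nhds x, z ≠ X := isOpen_ne.mem_nhds hx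
  have hx0 : x - X ≠ 0 := sub_ne_zero.mpr hx
  have hNf : (Nat.factorial N : ℝ) ≠ 0 := by exact_mod_cast Nat.factorial_ne_zero N
  have hul : ContDiffAt ℝ ℓ u x :=
    (hu.of_le (by exact_mod_cast (by omega : ℓ ≤ 2 * N))).contDiffAt
  have huNc : ContDiffAt ℝ ℓ uN x := by
    have h : ContDiffAt ℝ ℓ (fun x => (Nat.factorial N : ℝ) / (x - X) ^ N *
      (u x - ∑ n ∈ Finset.range N,
        iteratedDeriv n u X * (x - X) ^ n / (Nat.factorial n : ℝ))) x := by
      refine ContDiffAt.mul ?_ (ContDiffAt.sub hul ?_)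
      · exact contDiffAt_const.div (by fun_prop) (pow_ne_zero _ hx0)
      · fun_prop
    refine h.congr_of_eventuallyEq ?_
    filter_upwards [hne] with z hz using huN z hz
  have hrep : u =ᶠ[nhds x] fun z =>
      (∑ n ∈ Finset.range N, iteratedDeriv n u X * ((z - X) ^ n / (Nat.factorial n : ℝ)))
      + ((z - X) ^ N / (Nat.factorial N : ℝ)) * uN z := by
    filter_upwards [hne] with z hz
    have hz0 : z - X ≠ 0 := sub_ne_zero.mpr hz
    rw [huN z hz]
    simp only [← mul_div_assoc]
    field_simp
    ring
  rw [hrep.iteratedDeriv_eq, iteratedDeriv_fun_add (by fun_prop) (by fun_prop),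
    iteratedDeriv_fun_sum (by intros; fun_prop), iteratedDeriv_fun_mul (by fun_prop) huNc]
  congr 1
  · simp only [iteratedDeriv_const_mul_field, iteratedDeriv_taylor_monomial]
    obtain ⟨m, rfl⟩ := Nat.exists_eq_add_of_le hℓ
    rw [Finset.sum_range_add, Finset.sum_eq_zero, zero_add]
    · simp only [Nat.add_sub_cancel_left]
      refine Finset.sum_congr rfl fun n _ => ?_
      rw [if_pos (by omega), add_comm ℓ n, mul_div_assoc]
    · intro n hn
      rw [if_neg (by simpa using hn), mul_zero]
  · refine Finset.sum_nbij' (fun i => N - i) (fun n => N - n) ?_ ?_ ?_ ?_ ?_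
    · intro i hi
      simp only [Finset.mem_range, Finset.mem_Icc] at *
      omega
    · intro i hi
      simp only [Finset.mem_range, Finset.mem_Icc] at *
      omega
    · intro i hi
      simp only [Finset.mem_range] at *
      omega
    · intro i hi
      simp only [Finset.mem_Icc] at *
      omega
    · intro i hi
      simp only [Finset.mem_range] at hi
      rw [iteratedDeriv_taylor_monomial, if_pos (by omega),
        show N - (N - i) = i by omega, show N - i + ℓ - N = ℓ - i by omega]
      ring
end

section
/- Let w_c, w_d : ℝ → ℝ be continuous, and let Z denote the history convolution (Z f)(t) := ∫₀ᵗ e^{s−t} f(s) ds. Suppose C₀,…,C₄, D₀,…,D₄ : ℝ → ℝ are differentiable and satisfy the separated system D₀' = −D₀ − D₂ + D₄, D₁' = −D₁ − D₃, D₂' = −D₂ − D₄, D₃' = −D₃, D₄' = −D₄, and C₀' = C₂ − C₄ + 5·Z w_d + 5·Z(Z w_d), C₁' = C₃ − 5·Z(Z w_c), C₂' = C₄ − 5·Z w_d, C₃' = 5·Z w_c, C₄' = 5·w_d. Define c₀ := C₀ − D₁ + D₃, c₁ := C₁ − D₂ + D₄, c₂ := C₂ − D₃, c₃ := C₃ −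 D₄, c₄ := C₄, and d₀ := D₀ + C₁ − C₃ + 5·Z(Z w_c) + 5·Z(Z(Z w_c)), d₁ := D₁ + C₂ − C₄ + 5·Z w_d + 5·Z(Z w_d), d₂ := D₂ + C₃ − 5·Z(Z w_c), d₃ := D₃ + C₄ − 5·Z w_d, d₄ := D₄ + 5·Z w_c. Then these functions exactly satisfy the local heat-exchanger system: c₀' = d₁, c₁' = d₂, c₂' = d₃, c₃' = d₄, c₄' = 5·w_d, and d₀' = −d₀ + c₁, d₁' = −d₁ + c₂, d₂' = −d₂ + c₃, d₃' = −d₃ + c₄, d₄' = −d₄ + 5·w_c. -/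
open MeasureTheory intervalIntegral

/-- The explicit time-dependent coordinate transform exactly separates the slow
variables `Cₙ` from the decaying variables `Dₙ` of the local linear heat-exchanger
system with uncertain coupling `w_c`, `w_d`. -/
theorem heat_exchanger_normal_form_transform
    (wc wd : ℝ → ℝ) (hwc : Continuous wc) (hwd : Continuous wd)
    (Z : (ℝ → ℝ) → ℝ → ℝ)
    (hZ : ∀ (f : ℝ → ℝ) (t : ℝ), Z f t = ∫ s in (0:ℝ)..t, Real.exp (s - t) * f s)
    (C0 C1 C2 C3 C4 D0 D1 D2 D3 D4 : ℝ → ℝ)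
    (hC0 : Differentiable ℝ C0) (hC1 : Differentiable ℝ C1)
    (hC2 : Differentiable ℝ C2) (hC3 : Differentiable ℝ C3)
    (hC4 : Differentiable ℝ C4)
    (hD0 : Differentiable ℝ D0) (hD1 : Differentiable ℝ D1)
    (hD2 : Differentiable ℝ D2) (hD3 : Differentiable ℝ D3)
    (hD4 : Differentiable ℝ D4)
    (odeD0 : ∀ t, deriv D0 t = -D0 t - D2 t + D4 t)
    (odeD1 : ∀ t, deriv D1 t = -D1 t - D3 t)
    (odeD2 : ∀ t, deriv D2 t = -D2 t - D4 t)
    (odeD3 : ∀ t, deriv D3 t = -D3 t)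
    (odeD4 : ∀ t, deriv D4 t = -D4 t)
    (odeC0 : ∀ t, deriv C0 t = C2 t - C4 t + 5 * Z wd t + 5 * Z (Z wd) t)
    (odeC1 : ∀ t, deriv C1 t = C3 t - 5 * Z (Z wc) t)
    (odeC2 : ∀ t, deriv C2 t = C4 t - 5 * Z wd t)
    (odeC3 : ∀ t, deriv C3 t = 5 * Z wc t)
    (odeC4 : ∀ t, deriv C4 t = 5 * wd t)
    (c0 c1 c2 c3 c4 d0 d1 d2 d3 d4 : ℝ → ℝ)
    (hc0 : ∀ t, c0 t = C0 t - D1 t + D3 t)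
    (hc1 : ∀ t, c1 t = C1 t - D2 t + D4 t)
    (hc2 : ∀ t, c2 t = C2 t - D3 t)
    (hc3 : ∀ t, c3 t = C3 t - D4 t)
    (hc4 : ∀ t, c4 t = C4 t)
    (hd0 : ∀ t, d0 t = D0 t + C1 t - C3 t + 5 * Z (Z wc) t + 5 * Z (Z (Z wc)) t)
    (hd1 : ∀ t, d1 t = D1 t + C2 t - C4 t + 5 * Z wd t + 5 * Z (Z wd) t)
    (hd2 : ∀ t, d2 t = D2 t + C3 t - 5 * Z (Z wc) t)
    (hd3 : ∀ t, d3 t = D3 t + C4 t - 5 * Z wd t)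
    (hd4 : ∀ t, d4 t = D4 t + 5 * Z wc t) :
    (∀ t, deriv c0 t = d1 t) ∧ (∀ t, deriv c1 t = d2 t) ∧
    (∀ t, deriv c2 t = d3 t) ∧ (∀ t, deriv c3 t = d4 t) ∧
    (∀ t, deriv c4 t = 5 * wd t) ∧
    (∀ t, deriv d0 t = -d0 t + c1 t) ∧ (∀ t, deriv d1 t = -d1 t + c2 t) ∧
    (∀ t, deriv d2 t = -d2 t + c3 t) ∧ (∀ t, deriv d3 t = -d3 t + c4 t) ∧
    (∀ t, deriv d4 t = -d4 t + 5 * wc t) := by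
  have Zd : ∀ f : ℝ → ℝ, Continuous f → ∀ t, HasDerivAt (Z f) (f t - Z f t) t := by
    intro f hf t
    have e : ∀ t, Z f t = Real.exp (-t) * ∫ s in (0:ℝ)..t, Real.exp s * f s := by
      intro t
      rw [hZ, ← intervalIntegral.integral_const_mul]
      congr 1
      funext s
      rw [sub_eq_add_neg, Real.exp_add]
      ring
    have hc : Continuous (fun s => Real.exp s * f s) := Real.continuous_exp.mul hf
    have h1 : HasDerivAt (fun t => ∫ s in (0:ℝ)..t, Real.exp s * f s) (Real.exp t * f t) t :=
      hc.integral_hasStrictDerivAt 0 t |>.hasDerivAt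
    have h2 : HasDerivAt (fun t : ℝ => Real.exp (-t)) (Real.exp (-t) * (-1)) t :=
      (hasDerivAt_neg t).exp
    have h3 := h2.mul h1
    have e' : Z f = (fun t : ℝ => Real.exp (-t)) * (fun t => ∫ s in (0:ℝ)..t, Real.exp s * f s) :=
      funext e
    have h4 : Real.exp (-t) * Real.exp t = 1 := by rw [← Real.exp_add]; simp
    rw [e t, e']
    refine h3.congr_deriv ?_
    linear_combination f t * h4
  have Zc : ∀ f : ℝ → ℝ, Continuous f → Continuous (Z f) := fun f hf =>
    continuous_iff_continuousAt.2 fun t => (Zd f hf t).continuousAt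
  have zc1 := Zd wc hwc
  have zc2 := Zd _ (Zc wc hwc)
  have zc3 := Zd _ (Zc _ (Zc wc hwc))
  have zd1 := Zd wd hwd
  have zd2 := Zd _ (Zc wd hwd)
  have kC0 := fun t => (hC0 t).hasDerivAt
  simp only [odeC0] at kC0
  have kC1 := fun t => (hC1 t).hasDerivAt
  simp only [odeC1] at kC1
  have kC2 := fun t => (hC2 t).hasDerivAt
  simp only [odeC2] at kC2
  have kC3 := fun t => (hC3 t).hasDerivAt
  simp only [odeC3] at kC3
  have kC4 := fun t => (hC4 t).hasDerivAt
  simp only [odeC4] at kC4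
  have kD0 := fun t => (hD0 t).hasDerivAt
  simp only [odeD0] at kD0
  have kD1 := fun t => (hD1 t).hasDerivAt
  simp only [odeD1] at kD1
  have kD2 := fun t => (hD2 t).hasDerivAt
  simp only [odeD2] at kD2
  have kD3 := fun t => (hD3 t).hasDerivAt
  simp only [odeD3] at kD3
  have kD4 := fun t => (hD4 t).hasDerivAt
  simp only [odeD4] at kD4
  refine ⟨?_, ?_, ?_, ?_, ?_, ?_, ?_, ?_, ?_, ?_⟩ <;> intro t
  · have h := ((kC0 t).sub (kD1 t)).add (kD3 t)
    refine ((h.congr_of_eventuallyEq (Filter.Eventually.of_forall hc0)).deriv).trans ?_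
    rw [hd1 t]
    ring
  · have h := ((kC1 t).sub (kD2 t)).add (kD4 t)
    refine ((h.congr_of_eventuallyEq (Filter.Eventually.of_forall hc1)).deriv).trans ?_
    rw [hd2 t]
    ring
  · have h := (kC2 t).sub (kD3 t)
    refine ((h.congr_of_eventuallyEq (Filter.Eventually.of_forall hc2)).deriv).trans ?_
    rw [hd3 t]
    ring
  · have h := (kC3 t).sub (kD4 t)
    refine ((h.congr_of_eventuallyEq (Filter.Eventually.of_forall hc3)).deriv).trans ?_
    rw [hd4 t]
    ring
  · have h := kC4 t
    refine ((h.congr_of_eventuallyEq (Filter.Eventually.of_forall hc4)).deriv).trans ?_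
    rfl
  · have h := ((((kD0 t).add (kC1 t)).sub (kC3 t)).add ((zc2 t).const_mul 5)).add ((zc3 t).const_mul 5)
    refine ((h.congr_of_eventuallyEq (Filter.Eventually.of_forall hd0)).deriv).trans ?_
    rw [hd0 t, hc1 t]
    ring
  · have h := ((((kD1 t).add (kC2 t)).sub (kC4 t)).add ((zd1 t).const_mul 5)).add ((zd2 t).const_mul 5)
    refine ((h.congr_of_eventuallyEq (Filter.Eventually.of_forall hd1)).deriv).trans ?_
    rw [hd1 t, hc2 t]
    ring
  · have h := ((kD2 t).add (kC3 t)).sub ((zc2 t).const_mul 5)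
    refine ((h.congr_of_eventuallyEq (Filter.Eventually.of_forall hd2)).deriv).trans ?_
    rw [hd2 t, hc3 t]
    ring
  · have h := ((kD3 t).add (kC4 t)).sub ((zd1 t).const_mul 5)
    refine ((h.congr_of_eventuallyEq (Filter.Eventually.of_forall hd3)).deriv).trans ?_
    rw [hd3 t, hc4 t]
    ring
  · have h := (kD4 t).add ((zc1 t).const_mul 5)
    refine ((h.congr_of_eventuallyEq (Filter.Eventually.of_forall hd4)).deriv).trans ?_
    rw [hd4 t]
    ring
end

section
/- Let 𝔲 : ℝ × ℝ × ℝ → ℝ, (x, y, t) ↦ 𝔲(x, y, t), be infinitely differentiable and 2π-periodic in y, and suppose that at every point ∂𝔲/∂t = −( v + ∂²v/∂y² + 2·∂²v/∂y∂x + ∂²v/∂x² ), where v := 𝔲 + ∂²𝔲/∂y² + 2·∂²𝔲/∂y∂x + ∂²𝔲/∂x²; that is, 𝔲 solves the embedding equation ∂_t𝔲 = −(1 + ∂_yy + 2∂_{yx} + ∂_{xx})²𝔲. Then for every constant phase φ ∈ ℝ, the function u(x, t) := 𝔲(x, x + φ, t) satisfies the linear marginal Swift–Hohenberg equation ∂u/∂t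 = −( u + 2·∂²u/∂x² + ∂⁴u/∂x⁴ ) at every point; equivalently ∂_t u = −(1 + ∂_xx)²u. -/
/-- Partial derivative in the first (longitudinal) variable. -/
noncomputable def pX (F : ℝ → ℝ → ℝ → ℝ) : ℝ → ℝ → ℝ → ℝ :=
  fun x y t => deriv (fun ξ => F ξ y t) x

/-- Partial derivative in the second (cross-sectional phase) variable. -/
noncomputable def pY (F : ℝ → ℝ → ℝ → ℝ) : ℝ → ℝ → ℝ → ℝ :=
  fun x y t => deriv (fun η => F x η t) y

/-- Partial derivative in time. -/
noncomputable def pT (F : ℝ → ℝ → ℝ → ℝ) : ℝ → ℝ → ℝ → ℝ :=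
  fun x y t => deriv (fun τ => F x y τ) t

/-- The embedding operator `(1 + ∂_yy + 2∂_{yx} + ∂_{xx})` applied to `F`. -/
noncomputable def shOp (F : ℝ → ℝ → ℝ → ℝ) : ℝ → ℝ → ℝ → ℝ :=
  fun x y t => F x y t + pY (pY F) x y t + 2 * pX (pY F) x y t + pX (pX F) x y t

abbrev SmoothF (F : ℝ → ℝ → ℝ → ℝ) : Prop :=
  ContDiff ℝ (⊤ : ℕ∞) fun p : ℝ × ℝ × ℝ => F p.1 p.2.1 p.2.2

theorem pX_eq {F : ℝ → ℝ → ℝ → ℝ} (h : SmoothF F) (x y t : ℝ) :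
    pX F x y t = fderiv ℝ (fun p : ℝ × ℝ × ℝ => F p.1 p.2.1 p.2.2) (x, y, t) (1, 0, 0) := by
  have h1 := (h.differentiable (by simp) (x, y, t)).hasFDerivAt
  have h2 : HasDerivAt (fun ξ : ℝ => (ξ, y, t)) (1, 0, 0) x :=
    (hasDerivAt_id x).prodMk (hasDerivAt_const x (y, t))
  exact (HasFDerivAt.comp_hasDerivAt x h1 h2).deriv

theorem pY_eq {F : ℝ → ℝ → ℝ → ℝ} (h : SmoothF F) (x y t : ℝ) :
    pY F x y t = fderiv ℝ (fun p : ℝ × ℝ × ℝ => F p.1 p.2.1 p.2.2) (x, y, t) (0, 1, 0) := by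
  have h1 := (h.differentiable (by simp) (x, y, t)).hasFDerivAt
  have h2 : HasDerivAt (fun η : ℝ => (x, η, t)) (0, 1, 0) y :=
    (hasDerivAt_const y x).prodMk ((hasDerivAt_id y).prodMk (hasDerivAt_const y t))
  exact (HasFDerivAt.comp_hasDerivAt y h1 h2).deriv

theorem line_hasDerivAt {F : ℝ → ℝ → ℝ → ℝ} (h : SmoothF F) (φ x t : ℝ) :
    HasDerivAt (fun ξ => F ξ (ξ + φ) t) (pX F x (x + φ) t + pY F x (x + φ) t) x := by
  have h1 := (h.differentiable (by simp) (x, x + φ, t)).hasFDerivAt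
  have h2 : HasDerivAt (fun ξ : ℝ => (ξ, ξ + φ, t)) (1, 1, 0) x :=
    (hasDerivAt_id x).prodMk (((hasDerivAt_id x).add_const φ).prodMk (hasDerivAt_const x t))
  have h3 := HasFDerivAt.comp_hasDerivAt x h1 h2
  rw [pX_eq h, pY_eq h, ← map_add]
  have e : ((1, 0, 0) : ℝ × ℝ × ℝ) + (0, 1, 0) = (1, 1, 0) := by simp
  rw [e]
  exact h3

theorem smooth_fderiv_apply {F : ℝ → ℝ → ℝ → ℝ} (h : SmoothF F) (v : ℝ × ℝ × ℝ) :
    ContDiff ℝ (⊤ : ℕ∞)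
      (fun p => fderiv ℝ (fun p : ℝ × ℝ × ℝ => F p.1 p.2.1 p.2.2) p v) :=
  (h.fderiv_right (m := (⊤ : ℕ∞)) (by simp)).clm_apply contDiff_const

theorem smooth_pX {F : ℝ → ℝ → ℝ → ℝ} (h : SmoothF F) : SmoothF (pX F) := by
  have := smooth_fderiv_apply h (1, 0, 0)
  simpa only [SmoothF, pX_eq h] using this

theorem smooth_pY {F : ℝ → ℝ → ℝ → ℝ} (h : SmoothF F) : SmoothF (pY F) := by
  have := smooth_fderiv_apply h (0, 1, 0)
  simpa only [SmoothF, pY_eq h] using this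

theorem pX_pY_comm {F : ℝ → ℝ → ℝ → ℝ} (h : SmoothF F) (x y t : ℝ) :
    pX (pY F) x y t = pY (pX F) x y t := by
  rw [pX_eq (smooth_pY h), pY_eq (smooth_pX h)]
  simp only [pX_eq h, pY_eq h]
  have hd : DifferentiableAt ℝ (fderiv ℝ (fun p : ℝ × ℝ × ℝ => F p.1 p.2.1 p.2.2)) (x, y, t) :=
    (h.fderiv_right (m := (⊤ : ℕ∞)) (by simp)).differentiable (by simp) _
  have hs : IsSymmSndFDerivAt ℝ (fun p : ℝ × ℝ × ℝ => F p.1 p.2.1 p.2.2) (x, y, t) :=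
    h.contDiffAt.isSymmSndFDerivAt (by
      rw [minSmoothness_of_isRCLikeNormedField]
      exact WithTop.coe_le_coe.2 (le_top : (2 : ℕ∞) ≤ ⊤))
  have e (v w : ℝ × ℝ × ℝ) :
      fderiv ℝ (fun p => fderiv ℝ (fun p : ℝ × ℝ × ℝ => F p.1 p.2.1 p.2.2) p v) (x, y, t) w
        = fderiv ℝ (fderiv ℝ (fun p : ℝ × ℝ × ℝ => F p.1 p.2.1 p.2.2)) (x, y, t) w v := by
    rw [fderiv_clm_apply hd (differentiableAt_const v)]
    simp
  exact (e _ _).trans ((hs.eq _ _).trans (e _ _).symm)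

theorem smooth_shOp {F : ℝ → ℝ → ℝ → ℝ} (h : SmoothF F) : SmoothF (shOp F) := by
  have h1 := smooth_pY (smooth_pY h)
  have h2 := smooth_pX (smooth_pY h)
  have h3 := smooth_pX (smooth_pX h)
  exact ((h.add h1).add (contDiff_const.mul h2)).add h3

theorem line_deriv_two {F : ℝ → ℝ → ℝ → ℝ} (h : SmoothF F) (φ t : ℝ) :
    deriv (deriv (fun ξ => F ξ (ξ + φ) t))
      = fun x => shOp F x (x + φ) t - F x (x + φ) t := by
  have e : deriv (fun ξ => F ξ (ξ + φ) t)
      = fun x => pX F x (x + φ) t + pY F x (x + φ) t :=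
    funext fun x => (line_hasDerivAt h φ x t).deriv
  rw [e]
  funext x
  have h1 := line_hasDerivAt (smooth_pX h) φ x t
  have h2 := line_hasDerivAt (smooth_pY h) φ x t
  refine (h1.add h2).deriv.trans ?_
  rw [← pX_pY_comm h]
  simp only [shOp]
  ring

/-- Restricting any smooth `2π`-periodic solution of the embedding equation
`∂_t𝔲 = −(1 + ∂_yy + 2∂_{yx} + ∂_{xx})²𝔲` to the line `y = x + φ` yields a
solution of the linear marginal Swift–Hohenberg equation
`∂_t u = −(u + 2u_xx + u_xxxx)`. -/
theorem embedding_solves_linear_swift_hohenberg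
    (𝔲 : ℝ → ℝ → ℝ → ℝ)
    (hsmooth : ContDiff ℝ (⊤ : ℕ∞) fun p : ℝ × ℝ × ℝ => 𝔲 p.1 p.2.1 p.2.2)
    (hper : ∀ x y t : ℝ, 𝔲 x (y + 2 * Real.pi) t = 𝔲 x y t)
    (hpde : ∀ x y t : ℝ, pT 𝔲 x y t = -(shOp (shOp 𝔲) x y t)) :
    ∀ φ : ℝ, ∀ x t : ℝ,
      deriv (fun τ => 𝔲 x (x + φ) τ) t
        = -((𝔲 x (x + φ) t)
            + 2 * iteratedDeriv 2 (fun ξ => 𝔲 ξ (ξ + φ) t) x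
            + iteratedDeriv 4 (fun ξ => 𝔲 ξ (ξ + φ) t) x) := by
  intro φ x t
  have hv := smooth_shOp hsmooth
  have e1 := line_deriv_two hsmooth φ t
  have e2 := line_deriv_two hv φ t
  have d1 : ∀ G : ℝ → ℝ, iteratedDeriv 2 G = deriv (deriv G) := fun G => by
    simp [iteratedDeriv_succ, iteratedDeriv_zero]
  have d2 : ∀ G : ℝ → ℝ, iteratedDeriv 4 G = deriv (deriv (deriv (deriv G))) := fun G => by
    simp [iteratedDeriv_succ, iteratedDeriv_zero]
  have s1 : deriv (fun ξ => shOp 𝔲 ξ (ξ + φ) t - 𝔲 ξ (ξ + φ) t)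
      = fun x => deriv (fun ξ => shOp 𝔲 ξ (ξ + φ) t) x - deriv (fun ξ => 𝔲 ξ (ξ + φ) t) x :=
    funext fun x => deriv_fun_sub (line_hasDerivAt hv φ x t).differentiableAt
      (line_hasDerivAt hsmooth φ x t).differentiableAt
  have dd {F : ℝ → ℝ → ℝ → ℝ} (h : SmoothF F) :
      DifferentiableAt ℝ (deriv (fun ξ => F ξ (ξ + φ) t)) x := by
    have e : deriv (fun ξ => F ξ (ξ + φ) t)
        = fun x => pX F x (x + φ) t + pY F x (x + φ) t :=
      funext fun x => (line_hasDerivAt h φ x t).deriv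
    rw [e]
    exact ((line_hasDerivAt (smooth_pX h) φ x t).add
      (line_hasDerivAt (smooth_pY h) φ x t)).differentiableAt
  have key : iteratedDeriv 4 (fun ξ => 𝔲 ξ (ξ + φ) t) x
      = (shOp (shOp 𝔲) x (x + φ) t - shOp 𝔲 x (x + φ) t)
        - (shOp 𝔲 x (x + φ) t - 𝔲 x (x + φ) t) := by
    rw [d2, e1, s1, deriv_fun_sub (dd hv) (dd hsmooth), e1, e2]
  have hp := hpde x (x + φ) t
  simp only [pT] at hp
  rw [hp, key, d1, e1]
  ring
end

section
/- Let r ∈ ℝ and let 𝔲 : ℝ × ℝ × ℝ → ℝ, (x, y, t) ↦ 𝔲(x, y, t), be infinitely differentiable and 2π-periodic in y, and suppose that at every point ∂𝔲/∂t = r·𝔲 − ( v + ∂²v/∂y² + 2·∂²v/∂y∂x + ∂²v/∂x² ) − 𝔲³, where v := 𝔲 + ∂²𝔲/∂y² + 2·∂²𝔲/∂y∂x + ∂²𝔲/∂x²; that is, 𝔲 solves ∂_t𝔲 = r𝔲 − (1 + ∂_yy + 2∂_{yx} + ∂_{xx})²𝔲 − 𝔲³. Then for every constant phase φ ∈ ℝ,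 the function u(x, t) := 𝔲(x, x + φ, t) satisfies the Swift–Hohenberg equation ∂u/∂t = r·u − ( u + 2·∂²u/∂x² + ∂⁴u/∂x⁴ ) − u³ at every point; equivalently ∂_t u = ru − (1 + ∂_xx)²u − u³. -/
/-- Joint smoothness of a curried function of three real variables. -/
def Smooth3 (F : ℝ → ℝ → ℝ → ℝ) : Prop :=
  ContDiff ℝ (⊤ : ℕ∞) fun p : ℝ × ℝ × ℝ => F p.1 p.2.1 p.2.2

/-- The uncurried function. -/
def unc (F : ℝ → ℝ → ℝ → ℝ) : ℝ × ℝ × ℝ → ℝ := fun p => F p.1 p.2.1 p.2.2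

lemma Smooth3.hasFDerivAt {F : ℝ → ℝ → ℝ → ℝ} (h : Smooth3 F) (p : ℝ × ℝ × ℝ) :
    HasFDerivAt (unc F) (fderiv ℝ (unc F) p) p :=
  (ContDiff.differentiable (f := unc F) h (by simp)).differentiableAt.hasFDerivAt

lemma Smooth3.hasX {F : ℝ → ℝ → ℝ → ℝ} (h : Smooth3 F) (x y t : ℝ) :
    HasDerivAt (fun ξ => F ξ y t) (fderiv ℝ (unc F) (x, y, t) (1, 0, 0)) x :=
  (h.hasFDerivAt (x, y, t)).comp_hasDerivAt (f := fun ξ : ℝ => ((ξ, y, t) : ℝ × ℝ × ℝ)) x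
    ((hasDerivAt_id x).prodMk ((hasDerivAt_const x y).prodMk (hasDerivAt_const x t)))

lemma Smooth3.hasY {F : ℝ → ℝ → ℝ → ℝ} (h : Smooth3 F) (x y t : ℝ) :
    HasDerivAt (fun η => F x η t) (fderiv ℝ (unc F) (x, y, t) (0, 1, 0)) y :=
  (h.hasFDerivAt (x, y, t)).comp_hasDerivAt (f := fun η : ℝ => ((x, η, t) : ℝ × ℝ × ℝ)) y
    ((hasDerivAt_const y x).prodMk ((hasDerivAt_id y).prodMk (hasDerivAt_const y t)))

lemma Smooth3.pX_eq {F : ℝ → ℝ → ℝ → ℝ} (h : Smooth3 F) (x y t : ℝ) :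
    pX F x y t = fderiv ℝ (unc F) (x, y, t) (1, 0, 0) := (h.hasX x y t).deriv

lemma Smooth3.pY_eq {F : ℝ → ℝ → ℝ → ℝ} (h : Smooth3 F) (x y t : ℝ) :
    pY F x y t = fderiv ℝ (unc F) (x, y, t) (0, 1, 0) := (h.hasY x y t).deriv

lemma Smooth3.fd {F : ℝ → ℝ → ℝ → ℝ} (h : Smooth3 F) :
    ContDiff ℝ (⊤ : ℕ∞) (fderiv ℝ (unc F)) :=
  ContDiff.fderiv_right (f := unc F) (n := (⊤ : ℕ∞)) h (by simp)

lemma Smooth3.unc_pX {F : ℝ → ℝ → ℝ → ℝ} (h : Smooth3 F) :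
    unc (pX F) = fun p => fderiv ℝ (unc F) p (1, 0, 0) := by
  funext p; exact h.pX_eq _ _ _

lemma Smooth3.unc_pY {F : ℝ → ℝ → ℝ → ℝ} (h : Smooth3 F) :
    unc (pY F) = fun p => fderiv ℝ (unc F) p (0, 1, 0) := by
  funext p; exact h.pY_eq _ _ _

lemma Smooth3.pX {F : ℝ → ℝ → ℝ → ℝ} (h : Smooth3 F) : Smooth3 (pX F) := by
  change ContDiff ℝ _ (unc (_root_.pX F))
  rw [h.unc_pX]
  exact h.fd.clm_apply contDiff_const

lemma Smooth3.pY {F : ℝ → ℝ → ℝ → ℝ} (h : Smooth3 F) : Smooth3 (pY F) := by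
  change ContDiff ℝ _ (unc (_root_.pY F))
  rw [h.unc_pY]
  exact h.fd.clm_apply contDiff_const

lemma Smooth3.comm {F : ℝ → ℝ → ℝ → ℝ} (h : Smooth3 F) (x y t : ℝ) :
    _root_.pY (_root_.pX F) x y t = _root_.pX (_root_.pY F) x y t := by
  rw [h.pX.pY_eq, h.pY.pX_eq, h.unc_pX, h.unc_pY]
  have hd : DifferentiableAt ℝ (fderiv ℝ (unc F)) (x, y, t) :=
    (h.fd.differentiable (by simp)).differentiableAt
  rw [fderiv_clm_apply hd (differentiableAt_const _),
    fderiv_clm_apply hd (differentiableAt_const _)]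
  have hs : IsSymmSndFDerivAt ℝ (unc F) (x, y, t) :=
    ContDiffAt.isSymmSndFDerivAt (n := (⊤ : ℕ∞))
      (ContDiff.contDiffAt (f := unc F) h) (by
        simp only [minSmoothness_of_isRCLikeNormedField]
        exact WithTop.coe_le_coe.2 (le_top : (2 : ℕ∞) ≤ ⊤))
  simpa using hs.eq (0, 1, 0) (1, 0, 0)

lemma Smooth3.diag {F : ℝ → ℝ → ℝ → ℝ} (h : Smooth3 F) (φ x t : ℝ) :
    HasDerivAt (fun ξ => F ξ (ξ + φ) t)
      (_root_.pX F x (x + φ) t + _root_.pY F x (x + φ) t) x := by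
  have := (h.hasFDerivAt (x, x + φ, t)).comp_hasDerivAt
    (f := fun ξ : ℝ => ((ξ, ξ + φ, t) : ℝ × ℝ × ℝ)) x
    ((hasDerivAt_id x).prodMk (((hasDerivAt_id x).add_const φ).prodMk (hasDerivAt_const x t)))
  rw [h.pX_eq, h.pY_eq, ← map_add,
    show ((1, 0, 0) : ℝ × ℝ × ℝ) + (0, 1, 0) = (1, 1, 0) by simp]
  exact this

lemma Smooth3.diag2 {F : ℝ → ℝ → ℝ → ℝ} (h : Smooth3 F) (φ t : ℝ) :
    deriv (deriv (fun ξ => F ξ (ξ + φ) t))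
      = fun x => shOp F x (x + φ) t - F x (x + φ) t := by
  have h1 : deriv (fun ξ => F ξ (ξ + φ) t)
      = fun x => _root_.pX F x (x + φ) t + _root_.pY F x (x + φ) t :=
    funext fun x => (h.diag φ x t).deriv
  rw [h1]
  funext x
  rw [((h.pX.diag φ x t).fun_add (h.pY.diag φ x t)).deriv, h.comm]
  simp only [shOp]
  ring

lemma Smooth3.shOp {F : ℝ → ℝ → ℝ → ℝ} (h : Smooth3 F) : Smooth3 (shOp F) :=
  ((ContDiff.add h h.pY.pY).add (contDiff_const.mul h.pY.pX)).add h.pX.pX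

lemma Smooth3.diag4 {F : ℝ → ℝ → ℝ → ℝ} (h : Smooth3 F) (φ t x : ℝ) :
    deriv (deriv (deriv (deriv (fun ξ => F ξ (ξ + φ) t)))) x
      = _root_.shOp (_root_.shOp F) x (x + φ) t - 2 * _root_.shOp F x (x + φ) t
        + F x (x + φ) t := by
  rw [h.diag2]
  have h1 : deriv (fun x => _root_.shOp F x (x + φ) t - F x (x + φ) t)
      = fun x => deriv (fun x => _root_.shOp F x (x + φ) t) x
        - deriv (fun x => F x (x + φ) t) x :=
    funext fun x => deriv_fun_sub (h.shOp.diag φ x t).differentiableAt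
      (h.diag φ x t).differentiableAt
  have hd : ∀ {G : ℝ → ℝ → ℝ → ℝ}, Smooth3 G →
      DifferentiableAt ℝ (deriv (fun ξ => G ξ (ξ + φ) t)) x := by
    intro G hG
    rw [show deriv (fun ξ => G ξ (ξ + φ) t)
      = fun x => _root_.pX G x (x + φ) t + _root_.pY G x (x + φ) t from
      funext fun x => (hG.diag φ x t).deriv]
    exact ((hG.pX.diag φ x t).fun_add (hG.pY.diag φ x t)).differentiableAt
  rw [h1, deriv_fun_sub (hd h.shOp) (hd h), h.diag2, h.shOp.diag2]
  ring

/-- Restricting any smooth `2π`-periodic solution of the nonlinear embedding equation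
`∂_t𝔲 = r𝔲 − (1 + ∂_yy + 2∂_{yx} + ∂_{xx})²𝔲 − 𝔲³` to the line `y = x + φ` yields a
solution of the Swift–Hohenberg equation `∂_t u = ru − (u + 2u_xx + u_xxxx) − u³`. -/
theorem embedding_solves_swift_hohenberg
    (r : ℝ) (𝔲 : ℝ → ℝ → ℝ → ℝ)
    (hsmooth : ContDiff ℝ (⊤ : ℕ∞) fun p : ℝ × ℝ × ℝ => 𝔲 p.1 p.2.1 p.2.2)
    (hper : ∀ x y t : ℝ, 𝔲 x (y + 2 * Real.pi) t = 𝔲 x y t)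
    (hpde : ∀ x y t : ℝ,
      pT 𝔲 x y t = r * 𝔲 x y t - shOp (shOp 𝔲) x y t - (𝔲 x y t) ^ 3) :
    ∀ φ : ℝ, ∀ x t : ℝ,
      deriv (fun τ => 𝔲 x (x + φ) τ) t
        = r * 𝔲 x (x + φ) t
          - ((𝔲 x (x + φ) t)
              + 2 * iteratedDeriv 2 (fun ξ => 𝔲 ξ (ξ + φ) t) x
              + iteratedDeriv 4 (fun ξ => 𝔲 ξ (ξ + φ) t) x)
          - (𝔲 x (x + φ) t) ^ 3 := by
  intro φ x t
  have h : Smooth3 𝔲 := hsmooth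
  have h0 := hpde x (x + φ) t
  simp only [pT] at h0
  rw [h0]
  simp only [iteratedDeriv_succ, iteratedDeriv_zero]
  rw [h.diag4, h.diag2]
  ring
end

section
/- Let c : ℝ × ℝ → ℂ be infinitely differentiable and define u(x, t) := c(x, t)·e^{ix}. Then u satisfies the linear marginal Swift–Hohenberg equation ∂u/∂t = −( u + 2·∂²u/∂x² + ∂⁴u/∂x⁴ ) at every point if and only if the complex amplitude c satisfies ∂c/∂t = 4·∂²c/∂x² − 4i·∂³c/∂x³ − ∂⁴c/∂x⁴ at every point. -/
open Complex

theorem sh_step (f g : ℝ → ℂ) (h : ∀ x, HasDerivAt f (g x) x) :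
    deriv (fun x : ℝ => f x * Complex.exp (Complex.I * x))
      = fun x : ℝ => (g x + Complex.I * f x) * Complex.exp (Complex.I * x) := by
  funext x
  have h1 : HasDerivAt (fun y : ℝ => Complex.I * (y : ℂ)) (Complex.I * 1) x :=
    (Complex.ofRealCLM.hasDerivAt (x := x)).const_mul Complex.I
  have h2 := ((h x).mul h1.cexp).deriv
  refine h2.trans ?_
  ring

theorem sh_derivs (f : ℝ → ℂ) (hf : ContDiff ℝ (⊤ : ℕ∞) f) (x : ℝ) :
    iteratedDeriv 2 (fun x : ℝ => f x * Complex.exp (Complex.I * x)) x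
      = (iteratedDeriv 2 f x + 2 * Complex.I * iteratedDeriv 1 f x - f x)
        * Complex.exp (Complex.I * x) ∧
    iteratedDeriv 4 (fun x : ℝ => f x * Complex.exp (Complex.I * x)) x
      = (iteratedDeriv 4 f x + 4 * Complex.I * iteratedDeriv 3 f x - 6 * iteratedDeriv 2 f x
          - 4 * Complex.I * iteratedDeriv 1 f x + f x) * Complex.exp (Complex.I * x) := by
  have hd : ∀ (n : ℕ) (x : ℝ), HasDerivAt (iteratedDeriv n f) (iteratedDeriv (n + 1) f x) x := by
    intro n x
    rw [iteratedDeriv_succ]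
    exact ((hf.differentiable_iteratedDeriv n (by exact_mod_cast WithTop.coe_lt_top n)) x).hasDerivAt
  have h0 : ∀ x, HasDerivAt f (iteratedDeriv 1 f x) x := by
    intro x
    simpa using hd 0 x
  have e1 := sh_step f _ h0
  have k1 := fun x => (hd 1 x).add ((h0 x).const_mul Complex.I)
  have e2 := sh_step _ _ k1
  have k2 := fun x => ((hd 2 x).add ((hd 1 x).const_mul Complex.I)).add ((k1 x).const_mul Complex.I)
  have e3 := sh_step _ _ k2
  have k3 := fun x => (((hd 3 x).add ((hd 2 x).const_mul Complex.I)).add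
    (((hd 2 x).add ((hd 1 x).const_mul Complex.I)).const_mul Complex.I)).add
      ((k2 x).const_mul Complex.I)
  have e4 := sh_step _ _ k3
  simp only [Pi.add_apply] at e2 e3 e4
  have hI : Complex.I ^ 2 = -1 := Complex.I_sq
  have hI3 : Complex.I ^ 3 = -Complex.I := by rw [pow_succ, hI]; ring
  have hI4 : Complex.I ^ 4 = 1 := Complex.I_pow_four
  constructor
  · rw [iteratedDeriv_succ, iteratedDeriv_one, e1, e2]
    ring_nf
    simp only [hI]
    ring
  · rw [iteratedDeriv_succ, iteratedDeriv_succ, iteratedDeriv_succ, iteratedDeriv_one,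
      e1, e2, e3, e4]
    ring_nf
    simp only [hI, hI3, hI4]
    ring

/-- The exact modulation equation for the complex amplitude of the marginal pattern
`e^{ix}`: `u = c·e^{ix}` solves the linear marginal Swift–Hohenberg equation iff
`c` solves `∂_t c = 4c_xx − 4i c_xxx − c_xxxx`. -/
theorem linear_swift_hohenberg_amplitude_equation
    (c : ℝ × ℝ → ℂ) (hc : ContDiff ℝ (⊤ : ℕ∞) c)
    (u : ℝ → ℝ → ℂ)
    (hu : ∀ x t : ℝ, u x t = c (x, t) * Complex.exp (Complex.I * x)) :
    (∀ x t : ℝ,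
        deriv (fun τ => u x τ) t
          = -(u x t + 2 * iteratedDeriv 2 (fun ξ => u ξ t) x
              + iteratedDeriv 4 (fun ξ => u ξ t) x))
    ↔
    (∀ x t : ℝ,
        deriv (fun τ => c (x, τ)) t
          = 4 * iteratedDeriv 2 (fun ξ => c (ξ, t)) x
            - 4 * Complex.I * iteratedDeriv 3 (fun ξ => c (ξ, t)) x
            - iteratedDeriv 4 (fun ξ => c (ξ, t)) x) := by
  refine forall_congr' fun x => forall_congr' fun t => ?_
  have hs : ContDiff ℝ (⊤ : ℕ∞) (fun ξ : ℝ => c (ξ, t)) :=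
    hc.comp (contDiff_id.prodMk contDiff_const)
  have ht : ContDiff ℝ (⊤ : ℕ∞) (fun τ : ℝ => c (x, τ)) :=
    hc.comp (contDiff_const.prodMk contDiff_id)
  obtain ⟨h2, h4⟩ := sh_derivs _ hs x
  have hT : deriv (fun τ => c (x, τ) * Complex.exp (Complex.I * x)) t
      = deriv (fun τ => c (x, τ)) t * Complex.exp (Complex.I * x) :=
    deriv_mul_const ((ht.differentiable (by simp)) t) _
  simp only [hu]
  rw [h2, h4, hT, ← mul_left_inj' (Complex.exp_ne_zero (Complex.I * x))
    (a := deriv (fun τ => c (x, τ)) t)]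
  constructor <;> intro h <;> rw [h] <;> ring
end

section
/- Let N ≥ 1, m ≥ 1, γ > 0, and let B₀,…,B_N be m×m real matrices such that ⟨x, B₀·x⟩ ≤ −γ·‖x‖² for all x ∈ ℝ^m, and ‖Bₙ·x‖ ≤ (γ/N)·‖x‖ for all x ∈ ℝ^m and all 1 ≤ n ≤ N. Then for all vectors D₀,…,D_N ∈ ℝ^m: Σ_{0 ≤ n ≤ ν ≤ N} ⟨Dₙ, B_{ν−n}·D_ν⟩ ≤ −(γ/2) · Σ_{n=0}^{N} ‖Dₙ‖², where ⟨·,·⟩ and ‖·‖ are the Euclidean inner product and norm on ℝ^m. -/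
open Finset

/-- Euclidean inner product on `ℝ^m`. -/
def einner {m : ℕ} (x y : Fin m → ℝ) : ℝ := ∑ i, x i * y i

/-- Euclidean norm on `ℝ^m`. -/
noncomputable def enorm' {m : ℕ} (x : Fin m → ℝ) : ℝ := Real.sqrt (∑ i, x i ^ 2)

theorem einner_le_aux {m : ℕ} (x y : Fin m → ℝ) : einner x y ≤ enorm' x * enorm' y := by
  unfold einner enorm'
  exact Real.sum_mul_le_sqrt_mul_sqrt _ _ _

theorem sum_pairs_aux (N : ℕ) (a : Fin (N + 1) → ℝ) :
    ∑ n : Fin (N + 1), ∑ ν ∈ Finset.Icc n (Fin.last N), (a n + a ν)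
      = ((N : ℝ) + 2) * ∑ n, a n := by
  simp only [Finset.sum_add_distrib]
  have h2 : ∑ n : Fin (N + 1), ∑ ν ∈ Finset.Icc n (Fin.last N), a ν
      = ∑ ν : Fin (N + 1), ∑ n ∈ Finset.Iic ν, a ν := by
    apply Finset.sum_comm'
    intro x y
    simp [Fin.le_last]
  rw [h2, ← Finset.sum_add_distrib, Finset.mul_sum]
  apply Finset.sum_congr rfl
  intro n _
  have hn : (n : ℕ) ≤ N + 1 := n.2.le
  simp only [Finset.sum_const, Fin.card_Icc, Fin.card_Iic, Fin.val_last, nsmul_eq_mul]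
  push_cast [Nat.cast_sub hn]
  ring

/-- Key quadratic-form estimate for the block upper-triangular Toeplitz operator:
if `⟨x, B₀x⟩ ≤ −γ‖x‖²` and each off-diagonal block satisfies `‖Bₙx‖ ≤ (γ/N)‖x‖`,
then `Σ_{0 ≤ n ≤ ν ≤ N} ⟨Dₙ, B_{ν−n}D_ν⟩ ≤ −(γ/2)Σₙ‖Dₙ‖²`. -/
theorem block_toeplitz_quadratic_form_estimate
    (N m : ℕ) (hN : 1 ≤ N) (hm : 1 ≤ m) (γ : ℝ) (hγ : 0 < γ)
    (B : ℕ → Matrix (Fin m) (Fin m) ℝ)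
    (hB0 : ∀ x : Fin m → ℝ, einner x ((B 0).mulVec x) ≤ -γ * enorm' x ^ 2)
    (hBn : ∀ n, 1 ≤ n → n ≤ N →
      ∀ x : Fin m → ℝ, enorm' ((B n).mulVec x) ≤ (γ / N) * enorm' x) :
    ∀ D : Fin (N + 1) → Fin m → ℝ,
      (∑ n : Fin (N + 1), ∑ ν ∈ Finset.Icc n (Fin.last N),
          einner (D n) ((B ((ν : ℕ) - (n : ℕ))).mulVec (D ν)))
        ≤ -(γ / 2) * ∑ n : Fin (N + 1), enorm' (D n) ^ 2 := by
  intro D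
  have hN0 : (0 : ℝ) < N := by exact_mod_cast hN
  set c : ℝ := γ / (2 * N) with hc
  have hcN : c * N = γ / 2 := by rw [hc]; field_simp
  have key : ∀ n : Fin (N + 1), ∀ ν ∈ Finset.Icc n (Fin.last N),
      einner (D n) ((B ((ν : ℕ) - (n : ℕ))).mulVec (D ν)) ≤
        c * (enorm' (D n) ^ 2 + enorm' (D ν) ^ 2)
          - (if n = ν then (γ + 2 * c) * enorm' (D n) ^ 2 else 0) := by
    intro n ν hν
    have hle : n ≤ ν := (Finset.mem_Icc.mp hν).1
    by_cases h : n = ν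
    · subst h
      have := hB0 (D n)
      simp only [Nat.sub_self, if_true]
      linarith
    · have hlt : (n : ℕ) < ν := Fin.lt_def.mp (lt_of_le_of_ne hle h)
      have hν2 := ν.2
      have h1 := hBn ((ν : ℕ) - n) (by omega) (by omega) (D ν)
      have h2 := einner_le_aux (D n) ((B ((ν : ℕ) - (n : ℕ))).mulVec (D ν))
      have h3 : 0 ≤ enorm' (D n) := Real.sqrt_nonneg _
      have h4 := mul_le_mul_of_nonneg_left h1 h3
      have h5 : γ / N = 2 * c := by rw [hc]; field_simp
      have hc0 : 0 ≤ c := by positivity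
      rw [h5] at h4
      rw [if_neg h]
      nlinarith [mul_nonneg hc0 (sq_nonneg (enorm' (D n) - enorm' (D ν)))]
  refine (Finset.sum_le_sum fun n _ => Finset.sum_le_sum (key n)).trans ?_
  have hd : ∀ n : Fin (N + 1), ∑ ν ∈ Finset.Icc n (Fin.last N),
      (if n = ν then (γ + 2 * c) * enorm' (D n) ^ 2 else 0)
        = (γ + 2 * c) * enorm' (D n) ^ 2 := by
    intro n
    rw [Finset.sum_ite_eq, if_pos (Finset.mem_Icc.mpr ⟨le_rfl, Fin.le_last n⟩)]
  simp only [Finset.sum_sub_distrib, hd, ← Finset.mul_sum]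
  rw [sum_pairs_aux N (fun n => enorm' (D n) ^ 2)]
  apply le_of_eq
  linear_combination (∑ n : Fin (N + 1), enorm' (D n) ^ 2) * hcN
end

section
/- Let c₀, c₁, c₂, d₀, d₁, d₂ : ℝ → ℝ be differentiable and w_c, w_d : ℝ → ℝ be arbitrary functions, satisfying the six local ODEs: c₀' = d₁ − c₀d₀; c₁' = d₂ − c₀d₁ − c₁d₀; c₂' = 3w_d − c₀d₂ − 2c₁d₁ − c₂d₀; d₀' = −d₀ + c₁ − (c₀² + d₀²)/2; d₁' = −d₁ + c₂ − c₀c₁ − d₀d₁; d₂' = −d₂ + 3w_c − c₁² − c₀c₂ − d₁² − d₀d₂. Define the generating polynomials c̃(ξ,t) := c₀(t) + c₁(t)·ξ + c₂(t)·ξ²/2 and d̃(ξ,t) := d₀(t) + d₁(t)·ξ + d₂(t)·ξ²/2. Then for all ξ ∈ ℝ and all t, exactly: ∂c̃/∂t = ∂d̃/∂ξ − c̃·d̃ + (3/2)ξ²·w_d + (ξ³/2)·(c₁d₂ + c₂d₁) + (ξ⁴/4)·c₂d₂, and ∂d̃/∂t = −d̃ + ∂c̃/∂ξ − (c̃² +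 d̃²)/2 + (3/2)ξ²·w_c + (ξ³/2)·(c₁c₂ + d₁d₂) + (ξ⁴/8)·(c₂² + d₂²). -/
theorem heat_time_deriv (a b c : ℝ → ℝ) (ha : Differentiable ℝ a) (hb : Differentiable ℝ b)
    (hc : Differentiable ℝ c) (ξ t : ℝ) :
    deriv (fun τ => a τ + b τ * ξ + c τ * ξ ^ 2 / 2) t
      = deriv a t + deriv b t * ξ + deriv c t * ξ ^ 2 / 2 :=
  (((ha t).hasDerivAt.add ((hb t).hasDerivAt.mul_const ξ)).add
    (((hc t).hasDerivAt.mul_const (ξ ^ 2)).div_const 2)).deriv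

theorem heat_space_deriv (a b c ξ : ℝ) :
    deriv (fun z : ℝ => a + b * z + c * z ^ 2 / 2) ξ = b + c * ξ := by
  have h := ((((hasDerivAt_id ξ).const_mul b).const_add a).add
    ((((hasDerivAt_id ξ).pow 2).const_mul c).div_const 2))
  refine (HasDerivAt.congr_deriv h ?_).deriv
  simp
  ring

/-- The six local ODEs of the nonlinear heat exchanger at a station are exactly
equivalent to the two stated generating-polynomial equations, including the explicit
cubic and quartic terms in `ξ` that cancel those implicit in the quadratic
nonlinearities. -/
theorem heat_exchanger_generating_polynomial
    (c0 c1 c2 d0 d1 d2 : ℝ → ℝ) (wc wd : ℝ → ℝ)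
    (hc0 : Differentiable ℝ c0) (hc1 : Differentiable ℝ c1)
    (hc2 : Differentiable ℝ c2)
    (hd0 : Differentiable ℝ d0) (hd1 : Differentiable ℝ d1)
    (hd2 : Differentiable ℝ d2)
    (ode_c0 : ∀ t, deriv c0 t = d1 t - c0 t * d0 t)
    (ode_c1 : ∀ t, deriv c1 t = d2 t - c0 t * d1 t - c1 t * d0 t)
    (ode_c2 : ∀ t, deriv c2 t = 3 * wd t - c0 t * d2 t - 2 * c1 t * d1 t - c2 t * d0 t)
    (ode_d0 : ∀ t, deriv d0 t = -d0 t + c1 t - (c0 t ^ 2 + d0 t ^ 2) / 2)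
    (ode_d1 : ∀ t, deriv d1 t = -d1 t + c2 t - c0 t * c1 t - d0 t * d1 t)
    (ode_d2 : ∀ t, deriv d2 t
      = -d2 t + 3 * wc t - c1 t ^ 2 - c0 t * c2 t - d1 t ^ 2 - d0 t * d2 t)
    (tc td : ℝ → ℝ → ℝ)
    (htc : ∀ ξ t, tc ξ t = c0 t + c1 t * ξ + c2 t * ξ ^ 2 / 2)
    (htd : ∀ ξ t, td ξ t = d0 t + d1 t * ξ + d2 t * ξ ^ 2 / 2) :
    ∀ ξ t : ℝ,
      (deriv (fun τ => tc ξ τ) t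
        = deriv (fun z => td z t) ξ - tc ξ t * td ξ t + (3 / 2) * ξ ^ 2 * wd t
          + (ξ ^ 3 / 2) * (c1 t * d2 t + c2 t * d1 t) + (ξ ^ 4 / 4) * (c2 t * d2 t)) ∧
      (deriv (fun τ => td ξ τ) t
        = -td ξ t + deriv (fun z => tc z t) ξ - (tc ξ t ^ 2 + td ξ t ^ 2) / 2
          + (3 / 2) * ξ ^ 2 * wc t
          + (ξ ^ 3 / 2) * (c1 t * c2 t + d1 t * d2 t)
          + (ξ ^ 4 / 8) * (c2 t ^ 2 + d2 t ^ 2)) := by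
  intro ξ t
  simp only [htc, htd]
  rw [heat_time_deriv c0 c1 c2 hc0 hc1 hc2, heat_time_deriv d0 d1 d2 hd0 hd1 hd2,
    heat_space_deriv, heat_space_deriv, ode_c0, ode_c1, ode_c2, ode_d0, ode_d1, ode_d2]
  constructor <;> ring
end
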